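/- Let (X_n, x_n), n ≥ 1, and (X, x) be maximal Gromov product spaces whose Gromov product boundaries are finite sets (hence they are maximal Gromov hyperbolic spaces). Then (X_n, x_n) → (X, x) in the pointed Gromov–Hausdorff sense if and only if (∂_P X_n, ρ_{x_n}) AI-converges to (∂_P X, ρ_x). -/

import Mathlib

open Filter Topology Metric
open scoped ENNReal

universe u v

/-- A semi-metric (separating function) on a compact metrizable space: continuous, symmetric,
nonnegative, and vanishing exactly on the diagonal. -/
def IsSemiMetric {Z : Type*} [TopologicalSpace Z] (ρ : Z → Z → ℝ) : Prop :=
  Continuous (Function.uncurry ρ) ∧ (∀ ξ η, ρ ξ η = ρ η ξ) ∧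
    (∀ ξ η, 0 ≤ ρ ξ η) ∧ ∀ ξ η, ρ ξ η = 0 ↔ ξ = η

/-- An antipodal function: a semi-metric of diameter at most one such that every point has an
antipode at distance one. -/
def IsAntipodalFn {Z : Type*} [TopologicalSpace Z] (ρ : Z → Z → ℝ) : Prop :=
  IsSemiMetric ρ ∧ (∀ ξ η, ρ ξ η ≤ 1) ∧ ∀ ξ, ∃ η, ρ ξ η = 1

/-- An `ε`-isometry between semi-metric spaces: distortion less than `ε`, and the image is an
`ε`-net. -/
def IsEpsIsometry {Z₁ : Type*} {Z₂ : Type*} (ρ₁ : Z₁ → Z₁ → ℝ) (ρ₂ : Z₂ → Z₂ → ℝ)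
    (ε : ℝ) (f : Z₁ → Z₂) : Prop :=
  (∀ ξ η : Z₁, |ρ₂ (f ξ) (f η) - ρ₁ ξ η| < ε) ∧ ∀ ζ : Z₂, ∃ ξ : Z₁, ρ₂ (f ξ) ζ < ε

/-- AI-convergence of a sequence of semi-metric spaces `(Z n, ρ n)` to `(W, ρ₀)`: there are
`ε n`-isometries `(Z n, ρ n) → (W, ρ₀)` with `ε n → 0+`. -/
def AIConverges {Z : ℕ → Type u} (ρ : ∀ n, Z n → Z n → ℝ) {W : Type v} (ρ₀ : W → W → ℝ) : Prop :=
  ∃ ε : ℕ → ℝ, (∀ n, 0 < ε n) ∧ Tendsto ε atTop (𝓝 0) ∧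
    ∀ n, ∃ f : Z n → W, IsEpsIsometry (ρ n) ρ₀ (ε n) f

/-- Pointed Gromov–Hausdorff convergence of pointed metric spaces `(X n, p n) → (Y, q)`:
for every `R > 0` and `ε > 0`, for all sufficiently large `n` there is a map between the closed
balls of radius `R` around the base points, sending base point to base point, with distortion
less than `ε` and whose image is an `ε`-net. -/
def PointedGHConverges (X : ℕ → Type u) [∀ n, MetricSpace (X n)] (p : ∀ n, X n)
    (Y : Type v) [MetricSpace Y] (q : Y) : Prop :=
  ∀ (R : ℝ) (hR : 0 < R) (ε : ℝ) (_ : 0 < ε), ∃ N : ℕ, ∀ n, N ≤ n →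
    ∃ f : Metric.closedBall (p n) R → Metric.closedBall q R,
      ((f ⟨p n, Metric.mem_closedBall_self hR.le⟩ : Y) = q) ∧
      (∀ a b : Metric.closedBall (p n) R,
        |dist (f a : Y) (f b : Y) - dist (a : X n) (b : X n)| < ε) ∧
      ∀ z : Metric.closedBall q R, ∃ a : Metric.closedBall (p n) R, dist (f a : Y) (z : Y) < ε

/-- A geodesic segment from `x` to `y`, parametrized by arclength on `[0, dist x y]`. -/
def IsGeodesicSegment {X : Type*} [MetricSpace X] (γ : ℝ → X) (x y : X) : Prop :=
  γ 0 = x ∧ γ (dist x y) = y ∧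
    ∀ s ∈ Set.Icc (0:ℝ) (dist x y), ∀ t ∈ Set.Icc (0:ℝ) (dist x y), dist (γ s) (γ t) = |s - t|

/-- A geodesic metric space: any two points are joined by a geodesic segment. -/
def IsGeodesicSpace (X : Type*) [MetricSpace X] : Prop :=
  ∀ x y : X, ∃ γ : ℝ → X, IsGeodesicSegment γ x y

/-- Geodesic completeness: any geodesic segment extends to a bi-infinite geodesic. -/
def IsGeodesicallyComplete (X : Type*) [MetricSpace X] : Prop :=
  ∀ (x y : X) (γ : ℝ → X), IsGeodesicSegment γ x y →
    ∃ γ' : ℝ → X, (∀ s t : ℝ, dist (γ' s) (γ' t) = |s - t|) ∧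
      ∀ s ∈ Set.Icc (0:ℝ) (dist x y), γ' s = γ s

/-- The data of a Gromov product space: a proper, geodesic, geodesically complete metric space
`X` together with a second countable Hausdorff compactification on which all the Gromov products
`(·|·)_x` extend continuously (with values in `[0, ∞]`), the extension being `∞` at a pair of
boundary points iff the two points coincide. -/
structure GromovProductData (X : Type u) [MetricSpace X] : Type (u + 1) where
  geodesic : IsGeodesicSpace X
  geodesicallyComplete : IsGeodesicallyComplete X
  proper : ∀ (x : X) (r : ℝ), IsCompact (Metric.closedBall x r)
  Compactification : Type u
  [topC : TopologicalSpace Compactification]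
  compactC : CompactSpace Compactification
  t2C : T2Space Compactification
  secondCountableC : SecondCountableTopology Compactification
  incl : X → Compactification
  isEmbedding_incl : Topology.IsEmbedding incl
  dense_incl : Dense (Set.range incl)
  Boundary : Type u
  [topB : TopologicalSpace Boundary]
  bIncl : Boundary → Compactification
  isEmbedding_bIncl : Topology.IsEmbedding bIncl
  range_bIncl : Set.range bIncl = (Set.range incl)ᶜ
  gp : X → Compactification → Compactification → ℝ≥0∞
  continuous_gp : ∀ x : X,
    Continuous (fun pq : Compactification × Compactification => gp x pq.1 pq.2)
  gp_eq : ∀ x y z : X,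
    gp x (incl y) (incl z) = ENNReal.ofReal ((dist y x + dist z x - dist y z) / 2)
  gp_top_iff : ∀ (x : X) (ξ η : Boundary), gp x (bIncl ξ) (bIncl η) = ⊤ ↔ ξ = η

attribute [instance] GromovProductData.topC GromovProductData.topB

/-- The visual antipodal function `ρ_x = exp (−(·|·)_x)` on the Gromov product boundary. -/
noncomputable def GromovProductData.visual {X : Type u} [MetricSpace X]
    (D : GromovProductData X) (x : X) : D.Boundary → D.Boundary → ℝ :=
  fun ξ η =>
    if D.gp x (D.bIncl ξ) (D.bIncl η) = ⊤ then 0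
    else Real.exp (-(D.gp x (D.bIncl ξ) (D.bIncl η)).toReal)

/-- Maximality of a Gromov product space, via the equivalent characterization: for every `x`,
the visual embedding `y ↦ ρ_y` is an isometry of `X` onto the Moebius space
`𝓜(∂_P X, ρ_x)`, i.e. it is isometric (the distance of `y, z` equals the sup-norm of
`log (dρ_z/dρ_y)`) and surjective onto the set of antipodal functions Moebius equivalent
to `ρ_x`. -/
def GromovProductData.IsMaximal {X : Type u} [MetricSpace X] (D : GromovProductData X) : Prop :=
  ∀ x : X,
    (∀ y z : X, ∃ τ : D.Boundary → ℝ,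
      (∀ ξ η, D.visual z ξ η ^ 2 = Real.exp (τ ξ) * Real.exp (τ η) * D.visual y ξ η ^ 2) ∧
      IsLUB (Set.range fun ξ => |τ ξ|) (dist y z)) ∧
    ∀ β : D.Boundary → D.Boundary → ℝ, IsAntipodalFn β →
      (∃ τ : D.Boundary → ℝ, Continuous τ ∧
        ∀ ξ η, β ξ η ^ 2 = Real.exp (τ ξ) * Real.exp (τ η) * D.visual x ξ η ^ 2) →
      ∃ y : X, D.visual y = β

section TightFunctions

variable {Z : Type*} {G : Z → Z → ℝ}

/-- Functions satisfying all the constraints `τ ξ + τ η ≤ 2 (ξ|η)` for distinct `ξ`, `η`. -/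
def IsAdmissible (G : Z → Z → ℝ) (τ : Z → ℝ) : Prop :=
  ∀ ξ η, ξ ≠ η → τ ξ + τ η ≤ 2 * G ξ η

/-- Admissible functions such that every point takes part in an equality. -/
def IsTight (G : Z → Z → ℝ) (τ : Z → ℝ) : Prop :=
  IsAdmissible G τ ∧ ∀ ξ, ∃ η, ξ ≠ η ∧ τ ξ + τ η = 2 * G ξ η

theorem IsAdmissible.exists_isTight_ge [Finite Z] (hG : ∀ ξ η, G ξ η = G η ξ)
    (hne : ∀ ξ : Z, ∃ η, ξ ≠ η) {σ : Z → ℝ} (hσ : IsAdmissible G σ) :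
    ∃ τ, IsTight G τ ∧ ∀ ξ, σ ξ ≤ τ ξ := by
  classical
  have := Fintype.ofFinite Z
  have key : ∀ S : Finset Z, ∃ τ, IsAdmissible G τ ∧
      (∀ ξ ∈ S, ∃ η, ξ ≠ η ∧ τ ξ + τ η = 2 * G ξ η) ∧ ∀ ξ, σ ξ ≤ τ ξ := by
    intro S
    induction S using Finset.induction_on with
    | empty => exact ⟨σ, hσ, by simp, fun _ => le_rfl⟩
    | insert i S _ ih =>
      obtain ⟨τ, hτ, hS, hle⟩ := ih
      obtain ⟨j, hj, hmin⟩ := Finset.exists_min_image (Finset.univ.filter fun j => i ≠ j)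
        (fun j => 2 * G i j - τ j) (by obtain ⟨j, hj⟩ := hne i; exact ⟨j, by simpa using hj⟩)
      simp only [Finset.mem_filter, Finset.mem_univ, true_and] at hj hmin
      have hi : τ i ≤ 2 * G i j - τ j := by linarith [hτ i j hj]
      have hge : ∀ ξ, τ ξ ≤ Function.update τ i (2 * G i j - τ j) ξ := by
        intro ξ
        by_cases h : ξ = i
        · subst h; simpa using hi
        · simp [h]
      have hadm : IsAdmissible G (Function.update τ i (2 * G i j - τ j)) := by
        intro ξ η hne
        by_cases h : ξ = i
        · subst h
          simp only [Function.update_self, Function.update_of_ne hne.symm]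
          linarith [hmin η hne]
        · by_cases h' : η = i
          · subst h'
            simp only [Function.update_self, Function.update_of_ne hne]
            linarith [hmin ξ hne.symm, hG ξ η]
          · simp only [Function.update_of_ne h, Function.update_of_ne h']
            exact hτ ξ η hne
      refine ⟨_, hadm, ?_, fun ξ => (hle ξ).trans (hge ξ)⟩
      intro ξ hξ
      by_cases h : ξ = i
      · subst h
        refine ⟨j, hj, ?_⟩
        simp [Function.update_of_ne hj.symm]
      · obtain ⟨η, hη, heq⟩ := hS ξ (Finset.mem_of_mem_insert_of_ne hξ h)
        refine ⟨η, hη, le_antisymm (hadm ξ η hη) ?_⟩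
        linarith [hge ξ, hge η]
  obtain ⟨τ, h1, h2, h3⟩ := key Finset.univ
  exact ⟨τ, ⟨h1, fun ξ => h2 ξ (Finset.mem_univ _)⟩, h3⟩

theorem IsTight.le_add {τ σ : Z → ℝ} (hτ : IsTight G τ) (hσ : IsAdmissible G σ) {s : ℝ}
    (h : ∀ ξ, τ ξ - s ≤ σ ξ) (ξ : Z) : σ ξ ≤ τ ξ + s := by
  obtain ⟨η, hne, heq⟩ := hτ.2 ξ
  linarith [hσ ξ η hne, h η]

end TightFunctions

/-- The pointed metric space `(X, x)` is identified by `h` with the set of tight functions on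
`Z`, with the distance of the supremum norm, the base point corresponding to zero. -/
structure IsTightModel {X : Type*} [MetricSpace X] (x : X) {Z : Type*} (G : Z → Z → ℝ)
    (h : X → Z → ℝ) : Prop where
  symm : ∀ ξ η, G ξ η = G η ξ
  nonneg : ∀ ξ η, 0 ≤ G ξ η
  base : ∀ ξ, h x ξ = 0
  abs_sub_le : ∀ p q ξ, |h p ξ - h q ξ| ≤ dist p q
  exists_abs_sub_eq : ∀ p q, ∃ ξ, |h p ξ - h q ξ| = dist p q
  isTight : ∀ p, IsTight G (h p)
  surjective : ∀ τ, IsTight G τ → ∃ p, h p = τ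

namespace IsTightModel

variable {X : Type*} [MetricSpace X] {x : X} {Z : Type*} {G : Z → Z → ℝ} {h : X → Z → ℝ}

theorem abs_apply_le (H : IsTightModel x G h) (p : X) (ξ : Z) : |h p ξ| ≤ dist p x := by
  simpa [H.base] using H.abs_sub_le p x ξ

theorem dist_le (H : IsTightModel x G h) {p q : X} {s : ℝ} (hs : ∀ ξ, |h p ξ - h q ξ| ≤ s) :
    dist p q ≤ s := by
  obtain ⟨ξ, hξ⟩ := H.exists_abs_sub_eq p q
  exact hξ ▸ hs ξ

theorem dist_le_of_sub_le (H : IsTightModel x G h) {p c : X} {s : ℝ}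
    (hs : ∀ ξ, h c ξ - s ≤ h p ξ) : dist p c ≤ s := by
  refine H.dist_le fun ξ => abs_le.2 ⟨by linarith [hs ξ], ?_⟩
  linarith [(H.isTight c).le_add (H.isTight p).1 hs ξ]

theorem exists_ge [Finite Z] (H : IsTightModel x G h) {σ : Z → ℝ} (hσ : IsAdmissible G σ)
    (c : X) {s : ℝ} (hs : ∀ ξ, h c ξ - s ≤ σ ξ) : ∃ p, (∀ ξ, σ ξ ≤ h p ξ) ∧ dist p c ≤ s := by
  obtain ⟨τ, hτ, hle⟩ := hσ.exists_isTight_ge H.symm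
    fun ξ => (((H.isTight x).2 ξ).imp fun _ h => h.1)
  obtain ⟨p, rfl⟩ := H.surjective τ hτ
  exact ⟨p, hle, H.dist_le_of_sub_le fun ξ => (hs ξ).trans (hle ξ)⟩

/-- Every point lies on a geodesic ray from the base point. -/
theorem exists_eq_dist (H : IsTightModel x G h) (p : X) : ∃ ξ, h p ξ = dist p x := by
  obtain ⟨ξ, hξ⟩ := H.exists_abs_sub_eq p x
  rw [H.base, sub_zero] at hξ
  rcases le_or_gt 0 (h p ξ) with h0 | h0
  · exact ⟨ξ, by rw [← hξ, abs_of_nonneg h0]⟩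
  · obtain ⟨η, -, heq⟩ := (H.isTight p).2 ξ
    rw [abs_of_neg h0] at hξ
    refine ⟨η, le_antisymm ((le_abs_self _).trans (H.abs_apply_le p η)) ?_⟩
    linarith [H.nonneg ξ η]

theorem exists_extend [Finite Z] (H : IsTightModel x G h) {c : X} {ξ : Z} {R : ℝ}
    (hc : h c ξ = dist c x) (hR : dist c x ≤ R) :
    ∃ a, h a ξ = R ∧ dist a x = R ∧ dist a c ≤ R - dist c x := by
  classical
  have hadm : IsAdmissible G (Function.update (fun θ => h c θ - (R - dist c x)) ξ R) := by
    intro θ η hne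
    have := (H.isTight c).1 θ η hne
    by_cases h1 : θ = ξ
    · subst h1
      simp only [Function.update_self, Function.update_of_ne hne.symm]
      linarith
    · by_cases h2 : η = ξ
      · subst h2
        simp only [Function.update_self, Function.update_of_ne hne]
        linarith
      · simp only [Function.update_of_ne h1, Function.update_of_ne h2]
        linarith
  obtain ⟨a, ha, hd⟩ := H.exists_ge hadm c (s := R - dist c x) (by
    intro θ
    by_cases h1 : θ = ξ
    · subst h1
      simp only [Function.update_self]
      linarith
    · simp [Function.update_of_ne h1])
  have h1 := ha ξ
  simp only [Function.update_self] at h1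
  have h2 := (le_abs_self _).trans (H.abs_apply_le a ξ)
  have h3 := dist_triangle a c x
  exact ⟨a, by linarith, by linarith, hd⟩

theorem exists_sphere [Finite Z] (H : IsTightModel x G h) (ξ : Z) {R : ℝ} (hR : 0 ≤ R) :
    ∃ a, h a ξ = R ∧ dist a x = R := by
  obtain ⟨a, h1, h2, -⟩ := H.exists_extend (c := x) (ξ := ξ) (R := R) (by simp [H.base])
    (by simpa using hR)
  exact ⟨a, h1, h2⟩

theorem exists_midpoint [Finite Z] (H : IsTightModel x G h) {ξ : Z} {R : ℝ} {a b : X}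
    (ha : h a ξ = R) (hb : h b ξ = R) (ha' : dist a x = R) (hb' : dist b x = R) :
    ∃ m, h m ξ = R ∧ dist m x = R ∧ dist m a ≤ dist a b / 2 ∧ dist m b ≤ dist a b / 2 := by
  have hadm : IsAdmissible G (fun θ => (h a θ + h b θ) / 2) := by
    intro θ η hne
    linarith [(H.isTight a).1 θ η hne, (H.isTight b).1 θ η hne]
  have hab : ∀ θ, h a θ - h b θ ≤ dist a b := fun θ => (le_abs_self _).trans (H.abs_sub_le a b θ)
  have hba : ∀ θ, h b θ - h a θ ≤ dist a b := fun θ => by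
    linarith [neg_abs_le (h a θ - h b θ), H.abs_sub_le a b θ]
  obtain ⟨m, hm, hd⟩ := H.exists_ge hadm x (s := R) (by
    intro θ
    rw [H.base]
    linarith [neg_abs_le (h a θ), neg_abs_le (h b θ), H.abs_apply_le a θ, H.abs_apply_le b θ])
  have h1 := hm ξ
  have h2 := (le_abs_self _).trans (H.abs_apply_le m ξ)
  refine ⟨m, by linarith, by linarith, ?_, ?_⟩
  · exact H.dist_le_of_sub_le fun θ => by linarith [hm θ, hab θ]
  · exact H.dist_le_of_sub_le fun θ => by linarith [hm θ, hba θ]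

theorem exists_pair [Finite Z] (H : IsTightModel x G h) {ξ η : Z} (hne : ξ ≠ η) {R : ℝ}
    (hR : 0 ≤ R) : ∃ a b, h a ξ = R ∧ dist a x = R ∧ h b η = R ∧ dist b x = R ∧
      dist a b = 2 * R - 2 * min (G ξ η) R := by
  classical
  have hg0 : 0 ≤ min (G ξ η) R := le_min (H.nonneg _ _) hR
  have hgG := min_le_left (G ξ η) R
  have hgR := min_le_right (G ξ η) R
  have hcase : min (G ξ η) R = G ξ η ∨ min (G ξ η) R = R := min_choice _ _
  generalize min (G ξ η) R = g at *
  obtain ⟨c, hc, hd⟩ := H.exists_ge (σ := fun θ => if θ = ξ ∨ θ = η then g else -g) (by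
    intro θ θ' hθ
    have h0 := H.nonneg θ θ'
    have hs := H.symm ξ η
    dsimp only
    split_ifs with h1 h2
    · rcases h1 with rfl | rfl <;> rcases h2 with rfl | rfl <;>
        first | exact absurd rfl hθ | linarith
    all_goals linarith) x (s := g) (by intro θ; rw [H.base]; split_ifs <;> linarith)
  have hξ := hc ξ
  have hη := hc η
  simp only [true_or, or_true, if_true] at hξ hη
  have hξ' := (le_abs_self _).trans (H.abs_apply_le c ξ)
  have hη' := (le_abs_self _).trans (H.abs_apply_le c η)
  obtain ⟨a, ha, hax, hac⟩ := H.exists_extend (c := c) (ξ := ξ) (R := R) (by linarith) (by linarith)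
  obtain ⟨b, hb, hbx, hbc⟩ := H.exists_extend (c := c) (ξ := η) (R := R) (by linarith) (by linarith)
  refine ⟨a, b, ha, hax, hb, hbx, le_antisymm ?_ ?_⟩
  · linarith [dist_triangle_right a b c]
  · rcases hcase with hg | hg
    · have h1 := (H.isTight b).1 ξ η hne
      have h2 := (le_abs_self _).trans (H.abs_sub_le a b ξ)
      linarith
    · rw [hg]; linarith [dist_nonneg (x := a) (y := b)]

section Sphere

variable {M : ℝ}

theorem eq_of_far (H : IsTightModel x G h) (hM : ∀ ξ η, ξ ≠ η → G ξ η ≤ M) {q : X} {ζ : Z}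
    (hq : h q ζ = dist q x) (hr : 2 * M < dist q x) {η : Z} (hne : ζ ≠ η) :
    h q η = 2 * G ζ η - dist q x := by
  have hneg : ∀ θ, ζ ≠ θ → h q θ < 0 := fun θ hθ => by
    linarith [(H.isTight q).1 ζ θ hθ, hM ζ θ hθ]
  obtain ⟨θ, hθ, heq⟩ := (H.isTight q).2 η
  by_cases hζ : ζ = θ
  · subst hζ
    linarith [H.symm ζ η]
  · linarith [hneg η hne, hneg θ hζ, H.nonneg η θ]

theorem dist_le_of_same (H : IsTightModel x G h) (hM : ∀ ξ η, ξ ≠ η → G ξ η ≤ M) {q q' : X}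
    {ζ : Z} (hq : h q ζ = dist q x) (hr : 2 * M < dist q x) (hq' : h q' ζ = dist q' x)
    (hr' : 2 * M < dist q' x) : dist q q' ≤ |dist q x - dist q' x| := by
  refine H.dist_le fun η => ?_
  by_cases hη : ζ = η
  · subst hη
    rw [hq, hq']
  · rw [H.eq_of_far hM hq hr hη, H.eq_of_far hM hq' hr' hη, abs_sub_comm]
    apply le_of_eq
    congr 1
    ring

theorem dist_eq_of_ne (H : IsTightModel x G h) (hM : ∀ ξ η, ξ ≠ η → G ξ η ≤ M) {q q' : X}
    {ζ ζ' : Z} (hne : ζ ≠ ζ') (hq : h q ζ = dist q x) (hr : 2 * M < dist q x)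
    (hq' : h q' ζ' = dist q' x) (hr' : 2 * M < dist q' x) :
    dist q q' = dist q x + dist q' x - 2 * G ζ ζ' := by
  have hMζ := hM ζ ζ' hne
  have hζ := H.nonneg ζ ζ'
  have hs := H.symm ζ ζ'
  apply le_antisymm
  · refine H.dist_le fun η => ?_
    by_cases h1 : ζ = η
    · subst h1
      rw [hq, H.eq_of_far hM hq' hr' hne.symm, abs_le]
      constructor <;> linarith
    · by_cases h2 : ζ' = η
      · subst h2
        rw [hq', H.eq_of_far hM hq hr hne, abs_le]
        constructor <;> linarith
      · rw [H.eq_of_far hM hq hr h1, H.eq_of_far hM hq' hr' h2, abs_le]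
        constructor <;> linarith [hM ζ η h1, hM ζ' η h2, H.nonneg ζ η, H.nonneg ζ' η]
  · have h1 := H.eq_of_far hM hq' hr' hne.symm
    have h2 := (le_abs_self _).trans (H.abs_sub_le q q' ζ)
    linarith

end Sphere

end IsTightModel

/-- A surjection of boundaries which collapses only pairs of points with Gromov product greater
than `R`, and changes the Gromov products of all other pairs by at most `δ`. -/
structure IsCoarseMatch {Z W : Type*} (G : Z → Z → ℝ) (G' : W → W → ℝ) (R δ : ℝ)
    (f : Z → W) : Prop where
  surjective : Function.Surjective f
  lt_of_eq : ∀ ξ η, ξ ≠ η → f ξ = f η → R < G ξ η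
  abs_sub_le : ∀ ξ η, f ξ ≠ f η → |G ξ η - G' (f ξ) (f η)| ≤ δ

section BallMaps

variable {X Y : Type*} [MetricSpace X] [MetricSpace Y] {x : X} {y : Y} {Z W : Type*}
  {G : Z → Z → ℝ} {G' : W → W → ℝ} {h : X → Z → ℝ} {h' : Y → W → ℝ}

/-- A map between the balls of radius `R` as in the definition of pointed Gromov–Hausdorff
convergence. -/
def IsBallApprox (x : X) (y : Y) (R ε : ℝ) (F : X → Y) : Prop :=
  F x = y ∧ (∀ a, dist a x ≤ R → dist (F a) y ≤ R) ∧
    (∀ a b, dist a x ≤ R → dist b x ≤ R → |dist (F a) (F b) - dist a b| < ε) ∧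
    ∀ z, dist z y ≤ R → ∃ a, dist a x ≤ R ∧ dist (F a) z < ε

theorem IsCoarseMatch.le_add_of_eq (H : IsTightModel x G h) {R δ : ℝ} {f : Z → W}
    (hf : IsCoarseMatch G G' R δ f) {a : X} (ha : dist a x ≤ R) {ξ ξ' : Z} (he : f ξ = f ξ') :
    h a ξ' ≤ h a ξ + 4 * δ := by
  obtain ⟨η, hne, heq⟩ := (H.isTight a).2 ξ
  have hb : ∀ θ, h a θ ≤ R := fun θ => ((le_abs_self _).trans (H.abs_apply_le a θ)).trans ha
  have hfη : f ξ ≠ f η := fun hfe => by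
    linarith [hf.lt_of_eq ξ η hne hfe, hb ξ, hb η]
  have hfη' : f ξ' ≠ f η := he ▸ hfη
  have h1 := abs_le.1 (hf.abs_sub_le ξ η hfη)
  have h2 := abs_le.1 (hf.abs_sub_le ξ' η hfη')
  rw [← he] at h2
  linarith [(H.isTight a).1 ξ' η (fun hh => hfη' (congrArg f hh))]

theorem IsCoarseMatch.exists_push [Finite W] (H : IsTightModel x G h) (H' : IsTightModel y G' h')
    {R δ : ℝ} {f : Z → W} (hf : IsCoarseMatch G G' R δ f) (hδ : 0 ≤ δ) {s : W → Z}
    (hs : ∀ ζ, f (s ζ) = ζ) {a : X} (ha : dist a x ≤ R) :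
    ∃ q, dist q y ≤ R ∧ ∀ ζ, |h' q ζ - h a (s ζ)| ≤ 7 * δ := by
  have hb : ∀ θ, h a θ ≤ R := fun θ => ((le_abs_self _).trans (H.abs_apply_le a θ)).trans ha
  have hadm : IsAdmissible G' (fun ζ => max (h a (s ζ) - δ) (-R)) := by
    intro ζ ζ' hne
    have hne' : f (s ζ) ≠ f (s ζ') := by rwa [hs, hs]
    have h1 := (H.isTight a).1 (s ζ) (s ζ') (fun hh => hne' (congrArg f hh))
    have h2 := abs_le.1 (hf.abs_sub_le _ _ hne')
    rw [hs, hs] at h2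
    have h3 := H'.nonneg ζ ζ'
    have hR : 0 ≤ R := dist_nonneg.trans ha
    dsimp only
    rcases max_choice (h a (s ζ) - δ) (-R) with e1 | e1 <;>
      rcases max_choice (h a (s ζ') - δ) (-R) with e2 | e2 <;> rw [e1, e2] <;>
      linarith [hb (s ζ), hb (s ζ')]
  obtain ⟨q, hq, hd⟩ := H'.exists_ge hadm y (s := R)
    (fun ζ => by rw [H'.base, zero_sub]; exact le_max_right _ _)
  have hq' : ∀ ζ, h a (s ζ) - δ ≤ h' q ζ := fun ζ => (le_max_left _ _).trans (hq ζ)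
  refine ⟨q, hd, fun ζ => abs_le.2 ⟨by linarith [hq' ζ], ?_⟩⟩
  obtain ⟨η, hne, heq⟩ := (H.isTight a).2 (s ζ)
  have hfη : f (s ζ) ≠ f η := fun hfe => by
    linarith [hf.lt_of_eq _ η hne hfe, hb (s ζ), hb η]
  have h1 := abs_le.1 (hf.abs_sub_le _ η hfη)
  rw [hs] at h1 hfη
  linarith [(H'.isTight q).1 ζ (f η) hfη, hq' (f η),
    hf.le_add_of_eq H ha (ξ := s (f η)) (ξ' := η) (hs _)]

theorem IsCoarseMatch.exists_pull [Finite Z] (H : IsTightModel x G h) (H' : IsTightModel y G' h')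
    {R δ : ℝ} {f : Z → W} (hf : IsCoarseMatch G G' R δ f) (hδ : 0 ≤ δ) {q : Y}
    (hq : dist q y ≤ R) :
    ∃ a, dist a x ≤ R ∧ ∀ ξ, |h a ξ - h' q (f ξ)| ≤ 3 * δ := by
  have hb : ∀ θ, h' q θ ≤ R := fun θ => ((le_abs_self _).trans (H'.abs_apply_le q θ)).trans hq
  have hadm : IsAdmissible G (fun ξ => max (h' q (f ξ) - δ) (-R)) := by
    intro ξ η hne
    have h3 := H.nonneg ξ η
    have hR : 0 ≤ R := dist_nonneg.trans hq
    have hmain : h' q (f ξ) + h' q (f η) - 2 * δ ≤ 2 * G ξ η := by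
      by_cases he : f ξ = f η
      · linarith [hf.lt_of_eq ξ η hne he, hb (f ξ), hb (f η)]
      · linarith [(H'.isTight q).1 _ _ he, abs_le.1 (hf.abs_sub_le _ _ he)]
    dsimp only
    rcases max_choice (h' q (f ξ) - δ) (-R) with e1 | e1 <;>
      rcases max_choice (h' q (f η) - δ) (-R) with e2 | e2 <;> rw [e1, e2] <;>
      linarith [hb (f ξ), hb (f η)]
  obtain ⟨a, ha, hd⟩ := H.exists_ge hadm x (s := R)
    (fun ζ => by rw [H.base, zero_sub]; exact le_max_right _ _)
  have ha' : ∀ ξ, h' q (f ξ) - δ ≤ h a ξ := fun ξ => (le_max_left _ _).trans (ha ξ)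
  refine ⟨a, hd, fun ξ => abs_le.2 ⟨by linarith [ha' ξ], ?_⟩⟩
  obtain ⟨ζ, hne, heq⟩ := (H'.isTight q).2 (f ξ)
  obtain ⟨η, rfl⟩ := hf.surjective ζ
  linarith [(H.isTight a).1 ξ η (fun hh => hne (congrArg f hh)), ha' η,
    abs_le.1 (hf.abs_sub_le _ _ hne)]

theorem IsCoarseMatch.exists_isBallApprox [Finite Z] [Finite W] (H : IsTightModel x G h)
    (H' : IsTightModel y G' h') {R δ ε : ℝ} {f : Z → W} (hf : IsCoarseMatch G G' R δ f)
    (hR : 0 ≤ R) (hδ : 0 ≤ δ) (hε : 22 * δ < ε) : ∃ F, IsBallApprox x y R ε F := by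
  choose s hs using hf.surjective
  have hpush : ∀ a, ∃ q, (a = x → q = y) ∧
      (dist a x ≤ R → dist q y ≤ R ∧ ∀ ζ, |h' q ζ - h a (s ζ)| ≤ 7 * δ) := by
    intro a
    by_cases hax : a = x
    · subst hax
      refine ⟨y, fun _ => rfl, fun _ => ⟨by simpa using hR, fun ζ => ?_⟩⟩
      simp only [H.base, H'.base, sub_zero, abs_zero]
      positivity
    · by_cases ha : dist a x ≤ R
      · obtain ⟨q, hq⟩ := hf.exists_push H H' hδ hs ha
        exact ⟨q, fun hh => absurd hh hax, fun _ => hq⟩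
      · exact ⟨y, fun hh => absurd hh hax, fun hh => absurd hh ha⟩
  choose F hFx hF using hpush
  refine ⟨F, hFx x rfl, fun a ha => (hF a ha).1, fun a b ha hb => ?_, fun z hz => ?_⟩
  · have hFa := fun ζ => abs_le.1 ((hF a ha).2 ζ)
    have hFb := fun ζ => abs_le.1 ((hF b hb).2 ζ)
    have h1 : dist (F a) (F b) ≤ dist a b + 14 * δ := H'.dist_le fun ζ => by
      have := abs_le.1 (H.abs_sub_le a b (s ζ))
      rw [abs_le]
      constructor <;> linarith [hFa ζ, hFb ζ]
    have h2 : dist a b ≤ dist (F a) (F b) + 22 * δ := H.dist_le fun ξ => by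
      have := abs_le.1 (H'.abs_sub_le (F a) (F b) (f ξ))
      have e1 : f (s (f ξ)) = f ξ := hs _
      have := hf.le_add_of_eq H ha e1
      have := hf.le_add_of_eq H ha e1.symm
      have := hf.le_add_of_eq H hb e1
      have := hf.le_add_of_eq H hb e1.symm
      rw [abs_le]
      constructor <;> linarith [hFa (f ξ), hFb (f ξ)]
    rw [abs_lt]
    constructor <;> linarith
  · obtain ⟨a, ha, haq⟩ := hf.exists_pull H H' hδ hz
    refine ⟨a, ha, lt_of_le_of_lt (H'.dist_le (s := 10 * δ) fun ζ => ?_) (by linarith)⟩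
    have h1 := abs_le.1 (haq (s ζ))
    have h2 := abs_le.1 ((hF a ha).2 ζ)
    rw [hs] at h1
    rw [abs_le]
    constructor <;> linarith

theorem IsBallApprox.exists_isCoarseMatch [Finite Z] [Finite W] (H : IsTightModel x G h)
    (H' : IsTightModel y G' h') {M : ℝ} (hM0 : 0 ≤ M) (hM : ∀ ξ η, ξ ≠ η → G' ξ η ≤ M)
    {R R₀ ε δ : ℝ} (hR : 2 * M + R₀ + 10 ≤ R) (hR₀ : 0 ≤ R₀) (hε1 : ε ≤ 1) (hεδ : 2 * ε ≤ δ)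
    {F : X → Y} (hF : IsBallApprox x y R ε F) : ∃ f, IsCoarseMatch G G' R₀ δ f := by
  obtain ⟨hFx, hFball, hFdist, hFnet⟩ := hF
  have hnorm : ∀ a, dist a x ≤ R → |dist (F a) y - dist a x| < ε := fun a ha => by
    have := hFdist a x ha (by rw [dist_self]; linarith)
    rwa [hFx] at this
  have hfar : ∀ a, dist a x = R → R - ε < dist (F a) y ∧ dist (F a) y ≤ R ∧
      2 * M < dist (F a) y := fun a ha => by
    have h1 := abs_lt.1 (hnorm a ha.le)
    refine ⟨by linarith, hFball a ha.le, by linarith⟩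
  have hclose : ∀ a b ζ ζ', dist a x = R → dist b x = R → h' (F a) ζ = dist (F a) y →
      h' (F b) ζ' = dist (F b) y → dist a b ≤ R → ζ = ζ' := by
    intro a b ζ ζ' ha hb hζ hζ' hab
    by_contra hne
    have h1 := H'.dist_eq_of_ne hM hne hζ (hfar a ha).2.2 hζ' (hfar b hb).2.2
    linarith [abs_lt.1 (hFdist a b ha.le hb.le), hfar a ha, hfar b hb, hM _ _ hne]
  have hR0 : 0 ≤ R := by linarith
  choose c hc hcx using fun ξ => H.exists_sphere ξ hR0
  choose f hf using fun ξ => H'.exists_eq_dist (F (c ξ))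
  have hclass : ∀ ξ a ζ, h a ξ = R → dist a x = R → h' (F a) ζ = dist (F a) y → ζ = f ξ := by
    intro ξ a ζ ha hax hζ
    obtain ⟨m, -, hmx, hma, hmc⟩ := H.exists_midpoint ha (hc ξ) hax (hcx ξ)
    obtain ⟨θ, hθ⟩ := H'.exists_eq_dist (F m)
    have hd : dist a (c ξ) ≤ 2 * R := by linarith [dist_triangle_right a (c ξ) x, hcx ξ]
    rw [← hclose m a θ ζ hmx hax hθ hζ (by linarith)]
    exact hclose m (c ξ) θ (f ξ) hmx (hcx ξ) hθ (hf ξ) (by linarith)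
  have hclass' : ∀ ξ a, h a ξ = R → dist a x = R → h' (F a) (f ξ) = dist (F a) y := by
    intro ξ a ha hax
    obtain ⟨θ, hθ⟩ := H'.exists_eq_dist (F a)
    rwa [← hclass ξ a θ ha hax hθ]
  refine ⟨f, fun ζ => ?_, fun ξ η hne he => ?_, fun ξ η hne => ?_⟩
  · obtain ⟨q, hq, hqy⟩ := H'.exists_sphere ζ hR0
    obtain ⟨a, ha, haq⟩ := hFnet q hqy.le
    have h1 := abs_lt.1 (hnorm a ha)
    have h2 := dist_triangle_left q y (F a)
    obtain ⟨ξ, hξ⟩ := H.exists_eq_dist a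
    obtain ⟨b, hb, hbx, hba⟩ := H.exists_extend hξ ha
    refine ⟨ξ, ?_⟩
    by_contra hne
    have h3 := H'.dist_eq_of_ne hM hne (hclass' ξ b hb hbx) (hfar b hbx).2.2
      (hq.trans hqy.symm) (by linarith)
    linarith [dist_triangle (F b) (F a) q, abs_lt.1 (hFdist b a hbx.le ha), hfar b hbx,
      hM _ _ hne]
  · obtain ⟨a, b, ha, hax, hb, hbx, hab⟩ := H.exists_pair hne hR0
    have h1 := hclass' ξ a ha hax
    have h2 := hclass' η b hb hbx
    rw [← he] at h2
    have h3 := H'.dist_le_of_same hM h1 (hfar a hax).2.2 h2 (hfar b hbx).2.2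
    have h4 : |dist (F a) y - dist (F b) y| ≤ ε := by
      rw [abs_le]
      constructor <;> linarith [hfar a hax, hfar b hbx]
    linarith [abs_lt.1 (hFdist a b hax.le hbx.le), min_le_left (G ξ η) R]
  · have hne' : ξ ≠ η := fun hh => hne (congrArg f hh)
    obtain ⟨a, b, ha, hax, hb, hbx, hab⟩ := H.exists_pair hne' hR0
    have h3 := H'.dist_eq_of_ne hM hne (hclass' ξ a ha hax) (hfar a hax).2.2
      (hclass' η b hb hbx) (hfar b hbx).2.2
    have h4 := abs_lt.1 (hFdist a b hax.le hbx.le)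
    have h5 := hM _ _ hne
    rcases min_choice (G ξ η) R with hg | hg <;> rw [hg] at hab
    · rw [abs_le]
      constructor <;> linarith [hfar a hax, hfar b hbx]
    · linarith [hfar a hax, hfar b hbx]

end BallMaps

section ExpNeg

variable {Z W : Type*}

open scoped Classical in
/-- The function `exp (-G)`, set to zero on the diagonal. -/
noncomputable def expNeg (G : Z → Z → ℝ) (ξ η : Z) : ℝ :=
  if ξ = η then 0 else Real.exp (-G ξ η)

theorem expNeg_self (G : Z → Z → ℝ) (ξ : Z) : expNeg G ξ ξ = 0 := if_pos rfl

theorem expNeg_of_ne (G : Z → Z → ℝ) {ξ η : Z} (hne : ξ ≠ η) :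
    expNeg G ξ η = Real.exp (-G ξ η) := if_neg hne

theorem expNeg_nonneg (G : Z → Z → ℝ) (ξ η : Z) : 0 ≤ expNeg G ξ η := by
  unfold expNeg
  split_ifs
  exacts [le_rfl, (Real.exp_pos _).le]

theorem expNeg_le_one {G : Z → Z → ℝ} (hG : ∀ ξ η, 0 ≤ G ξ η) (ξ η : Z) : expNeg G ξ η ≤ 1 := by
  unfold expNeg
  split_ifs
  · exact zero_le_one
  · exact Real.exp_le_one_iff.2 (by linarith [hG ξ η])

theorem Real.abs_exp_neg_sub_exp_neg_le {a b : ℝ} (ha : 0 ≤ a) (hb : 0 ≤ b) :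
    |Real.exp (-a) - Real.exp (-b)| ≤ |a - b| := by
  wlog hab : a ≤ b generalizing a b
  · rw [abs_sub_comm, abs_sub_comm a]
    exact this hb ha (le_of_not_ge hab)
  rw [abs_of_nonneg (sub_nonneg.2 (Real.exp_le_exp.2 (neg_le_neg hab))), abs_sub_comm,
    abs_of_nonneg (sub_nonneg.2 hab)]
  have h1 : Real.exp (-b) = Real.exp (-a) * Real.exp (-(b - a)) := by
    rw [← Real.exp_add]
    congr 1
    ring
  have h2 := Real.add_one_le_exp (-(b - a))
  have h3 : Real.exp (-a) ≤ 1 := Real.exp_le_one_iff.2 (by linarith)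
  have h4 : Real.exp (-(b - a)) ≤ 1 := Real.exp_le_one_iff.2 (by linarith)
  have h5 := mul_le_mul_of_nonneg_right h3 (sub_nonneg.2 h4)
  rw [h1]
  linarith

theorem Real.abs_sub_le_of_abs_exp_neg_sub_lt {a b M δ κ : ℝ} (hb : b ≤ M) (hδ : 0 ≤ δ)
    (hκ : κ ≤ Real.exp (-M) * (1 - Real.exp (-δ)))
    (h : |Real.exp (-b) - Real.exp (-a)| < κ) : |a - b| ≤ δ := by
  have h1 : κ ≤ Real.exp (-b) * (1 - Real.exp (-δ)) :=
    hκ.trans (mul_le_mul_of_nonneg_right (Real.exp_le_exp.2 (by linarith))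
      (sub_nonneg.2 (Real.exp_le_one_iff.2 (by linarith))))
  obtain ⟨h2, h3⟩ := abs_lt.1 h
  rw [abs_le]
  constructor <;> by_contra! hcon
  · have h4 : Real.exp (-b) * Real.exp δ ≤ Real.exp (-a) := by
      rw [← Real.exp_add]
      exact Real.exp_le_exp.2 (by linarith)
    have h5 := mul_le_mul_of_nonneg_left
      (by linarith [Real.add_one_le_exp δ, Real.add_one_le_exp (-δ)] :
        2 ≤ Real.exp δ + Real.exp (-δ)) (Real.exp_pos (-b)).le
    linarith
  · have h4 : Real.exp (-a) ≤ Real.exp (-b) * Real.exp (-δ) := by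
      rw [← Real.exp_add]
      exact Real.exp_le_exp.2 (by linarith)
    linarith

variable {G : Z → Z → ℝ} {G' : W → W → ℝ}

theorem IsCoarseMatch.isEpsIsometry (hG : ∀ ξ η, 0 ≤ G ξ η) (hG' : ∀ ξ η, 0 ≤ G' ξ η)
    {R δ ε : ℝ} (hδ : δ < ε) (hR : Real.exp (-R) < ε) (hε : 0 < ε) {f : Z → W}
    (hf : IsCoarseMatch G G' R δ f) : IsEpsIsometry (expNeg G) (expNeg G') ε f := by
  refine ⟨fun ξ η => ?_, fun ζ => ?_⟩
  · by_cases hne : ξ = η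
    · subst hne
      simpa [expNeg_self] using hε
    · by_cases he : f ξ = f η
      · rw [he, expNeg_self, expNeg_of_ne G hne, zero_sub, abs_neg, abs_of_pos (Real.exp_pos _)]
        exact (Real.exp_le_exp.2 (neg_le_neg (hf.lt_of_eq ξ η hne he).le)).trans_lt hR
      · rw [expNeg_of_ne G hne, expNeg_of_ne G' he, abs_sub_comm]
        exact ((Real.abs_exp_neg_sub_exp_neg_le (hG _ _) (hG' _ _)).trans
          (hf.abs_sub_le ξ η he)).trans_lt hδ
  · obtain ⟨ξ, rfl⟩ := hf.surjective ζ
    exact ⟨ξ, by rwa [expNeg_self]⟩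

theorem IsEpsIsometry.isCoarseMatch {M R δ κ : ℝ} (hM : ∀ ξ η, ξ ≠ η → G' ξ η ≤ M)
    (hδ : 0 ≤ δ) (hκM : κ ≤ Real.exp (-M) * (1 - Real.exp (-δ))) (hκR : κ ≤ Real.exp (-R))
    {f : Z → W} (hf : IsEpsIsometry (expNeg G) (expNeg G') κ f) : IsCoarseMatch G G' R δ f := by
  refine ⟨fun ζ => ?_, fun ξ η hne he => ?_, fun ξ η hne => ?_⟩
  · obtain ⟨ξ, hξ⟩ := hf.2 ζ
    refine ⟨ξ, ?_⟩
    by_contra hne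
    rw [expNeg_of_ne G' hne] at hξ
    have h1 := Real.exp_le_exp.2 (neg_le_neg (hM _ _ hne))
    have h2 := mul_nonneg (Real.exp_pos (-M)).le (Real.exp_pos (-δ)).le
    linarith
  · have h1 := hf.1 ξ η
    rw [he, expNeg_self, expNeg_of_ne G hne, zero_sub, abs_neg, abs_of_pos (Real.exp_pos _)] at h1
    have := Real.exp_lt_exp.1 (h1.trans_le hκR)
    linarith
  · have hne' : ξ ≠ η := fun hh => hne (congrArg f hh)
    have h1 := hf.1 ξ η
    rw [expNeg_of_ne G hne', expNeg_of_ne G' hne] at h1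
    exact Real.abs_sub_le_of_abs_exp_neg_sub_lt (hM _ _ hne) hδ hκM h1

end ExpNeg

theorem IsEpsIsometry.mono {Z W : Type*} {ρ : Z → Z → ℝ} {ρ' : W → W → ℝ} {ε ε' : ℝ}
    (hε : ε ≤ ε') {f : Z → W} (hf : IsEpsIsometry ρ ρ' ε f) : IsEpsIsometry ρ ρ' ε' f :=
  ⟨fun ξ η => (hf.1 ξ η).trans_le hε, fun ζ => (hf.2 ζ).imp fun _ h => h.trans_le hε⟩

theorem aiConverges_iff {Z : ℕ → Type u} {ρ : ∀ n, Z n → Z n → ℝ} {W : Type v} [Nonempty W]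
    {ρ₀ : W → W → ℝ} (hZ : ∀ n, Nonempty (Z n)) (h0 : ∀ n ξ η, 0 ≤ ρ n ξ η)
    (h1 : ∀ n ξ η, ρ n ξ η ≤ 1) (h0' : ∀ ξ η, 0 ≤ ρ₀ ξ η) (h1' : ∀ ξ η, ρ₀ ξ η ≤ 1) :
    AIConverges ρ ρ₀ ↔ ∀ ε > 0, ∃ N, ∀ n, N ≤ n → ∃ f, IsEpsIsometry (ρ n) ρ₀ ε f := by
  constructor
  · rintro ⟨e, -, he, hf⟩ ε hε
    obtain ⟨N, hN⟩ := eventually_atTop.1 (he.eventually (gt_mem_nhds hε))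
    exact ⟨N, fun n hn => (hf n).imp fun _ h => h.mono (hN n hn).le⟩
  · intro H
    let S : ℕ → Set ℝ := fun n => {ε | 0 < ε ∧ ∃ f, IsEpsIsometry (ρ n) ρ₀ ε f}
    have hbdd : ∀ n, BddBelow (S n) := fun n => ⟨0, fun ε hε => hε.1.le⟩
    have hne : ∀ n, (S n).Nonempty := by
      intro n
      refine ⟨2, two_pos, fun _ => Classical.arbitrary W, fun ξ η => ?_, fun ζ => ?_⟩
      · rw [abs_lt]
        constructor <;> linarith [h0 n ξ η, h1 n ξ η,
          h0' (Classical.arbitrary W) (Classical.arbitrary W),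
          h1' (Classical.arbitrary W) (Classical.arbitrary W)]
      · obtain ⟨ξ⟩ := hZ n
        exact ⟨ξ, by linarith [h1' (Classical.arbitrary W) ζ]⟩
    have hnonneg : ∀ n, 0 ≤ sInf (S n) := fun n => Real.sInf_nonneg fun ε hε => hε.1.le
    have hpos : ∀ n : ℕ, (0 : ℝ) < 1 / ((n : ℝ) + 1) := fun n => Nat.one_div_pos_of_nat
    refine ⟨fun n => sInf (S n) + 1 / ((n : ℝ) + 1), fun n => by linarith [hnonneg n, hpos n],
      ?_, fun n => ?_⟩
    · have hlim : Tendsto (fun n => sInf (S n)) atTop (𝓝 0) := by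
        rw [tendsto_order]
        refine ⟨fun a ha => Eventually.of_forall fun n => ha.trans_le (hnonneg n), fun a ha => ?_⟩
        obtain ⟨N, hN⟩ := H (a / 2) (half_pos ha)
        filter_upwards [eventually_ge_atTop N] with n hn
        exact (csInf_le (hbdd n) ⟨half_pos ha, hN n hn⟩).trans_lt (half_lt_self ha)
      simpa using hlim.add tendsto_one_div_add_atTop_nhds_zero_nat
    · obtain ⟨ε, hε, hlt⟩ := exists_lt_of_csInf_lt (hne n)
        (show sInf (S n) < sInf (S n) + 1 / ((n : ℝ) + 1) by linarith [hpos n])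
      exact hε.2.imp fun _ h => h.mono hlt.le

theorem pointedGHConverges_iff {X : ℕ → Type u} [∀ n, MetricSpace (X n)] {x : ∀ n, X n}
    {Y : Type v} [MetricSpace Y] {y : Y} :
    PointedGHConverges X x Y y ↔ ∀ R > 0, ∀ ε > 0, ∃ N, ∀ n, N ≤ n →
      ∃ F, IsBallApprox (x n) y R ε F := by
  classical
  refine forall₄_congr fun R hR ε hε => exists_congr fun N => forall₂_congr fun n hn => ?_
  constructor
  · rintro ⟨f, hfx, hfd, hfn⟩
    obtain ⟨F, hF⟩ : ∃ F : X n → Y, ∀ a (ha : a ∈ Metric.closedBall (x n) R), F a = f ⟨a, ha⟩ :=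
      ⟨fun a => if ha : a ∈ Metric.closedBall (x n) R then f ⟨a, ha⟩ else y, fun a ha => dif_pos ha⟩
    refine ⟨F, (hF _ _).trans hfx, fun a ha => ?_, fun a b ha hb => ?_, fun z hz => ?_⟩
    · rw [hF a ha]
      exact (f ⟨a, ha⟩).2
    · rw [hF a ha, hF b hb]
      exact hfd ⟨a, ha⟩ ⟨b, hb⟩
    · obtain ⟨a, ha⟩ := hfn ⟨z, hz⟩
      refine ⟨a, a.2, ?_⟩
      rw [hF a a.2]
      exact ha
  · rintro ⟨F, hFx, hFb, hFd, hFn⟩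
    refine ⟨fun a => ⟨F a, hFb a a.2⟩, hFx, fun a b => hFd a b a.2 b.2, fun z => ?_⟩
    obtain ⟨a, ha, hz⟩ := hFn z z.2
    exact ⟨⟨a, ha⟩, hz⟩

namespace GromovProductData

variable {X : Type u} [MetricSpace X] (D : GromovProductData X)

/-- The Gromov product of two boundary points, as a real number. -/
noncomputable def boundaryProd (x : X) (ξ η : D.Boundary) : ℝ :=
  (D.gp x (D.bIncl ξ) (D.bIncl η)).toReal

/-- The Busemann-type function `ξ ↦ lim (d(x, a) - d(p, a))` as `a` tends to `ξ`. -/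
noncomputable def busemann (x p : X) (ξ : D.Boundary) : ℝ :=
  2 * (D.gp x (D.incl p) (D.bIncl ξ)).toReal - dist x p

theorem continuous_gp_comp {T : Type*} [TopologicalSpace T] (x : X) {f g : T → D.Compactification}
    (hf : Continuous f) (hg : Continuous g) : Continuous fun t => D.gp x (f t) (g t) :=
  (D.continuous_gp x).comp (hf.prodMk hg)

theorem gp_comm (x : X) (a b : D.Compactification) : D.gp x a b = D.gp x b a := by
  refine isClosed_property2 (p := fun a b => D.gp x a b = D.gp x b a) D.dense_incl ?_ ?_ a b
  · exact isClosed_eq (D.continuous_gp_comp x continuous_fst continuous_snd)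
      (D.continuous_gp_comp x continuous_snd continuous_fst)
  · intro p q
    rw [gp_eq, gp_eq, dist_comm p q, add_comm]

theorem gp_incl_le (x p : X) (a : D.Compactification) :
    D.gp x (D.incl p) a ≤ ENNReal.ofReal (dist x p) := by
  refine D.dense_incl.induction (P := fun a => D.gp x (D.incl p) a ≤ _) ?_ ?_ a
  · rintro _ ⟨q, rfl⟩
    rw [gp_eq]
    refine ENNReal.ofReal_le_ofReal ?_
    linarith [dist_triangle_left q x p, dist_comm p x, dist_comm q x, dist_triangle x p q,
      dist_comm q p]
  · exact isClosed_le (D.continuous_gp_comp x continuous_const continuous_id) continuous_const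

theorem gp_incl_ne_top (x p : X) (a : D.Compactification) : D.gp x (D.incl p) a ≠ ⊤ :=
  ((D.gp_incl_le x p a).trans_lt ENNReal.ofReal_lt_top).ne

theorem gp_add_gp_add_gp (x p : X) (a b : D.Compactification) :
    D.gp p a b + D.gp x (D.incl p) a + D.gp x (D.incl p) b =
      D.gp x a b + ENNReal.ofReal (dist x p) := by
  refine isClosed_property2 (p := fun a b => D.gp p a b + D.gp x (D.incl p) a +
    D.gp x (D.incl p) b = D.gp x a b + ENNReal.ofReal (dist x p)) D.dense_incl ?_ ?_ a b
  · exact isClosed_eq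
      (((D.continuous_gp_comp p continuous_fst continuous_snd).add
        (D.continuous_gp_comp x continuous_const continuous_fst)).add
        (D.continuous_gp_comp x continuous_const continuous_snd))
      ((D.continuous_gp_comp x continuous_fst continuous_snd).add continuous_const)
  · intro q r
    have hnn : ∀ o u v : X, 0 ≤ (dist u o + dist v o - dist u v) / 2 := fun o u v => by
      linarith [dist_triangle_right u v o]
    rw [gp_eq, gp_eq, gp_eq, gp_eq, ← ENNReal.ofReal_add (hnn _ _ _) (hnn _ _ _),
      ← ENNReal.ofReal_add (add_nonneg (hnn _ _ _) (hnn _ _ _)) (hnn _ _ _),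
      ← ENNReal.ofReal_add (hnn _ _ _) dist_nonneg]
    congr 1
    rw [dist_comm p q, dist_comm p r, dist_comm x p]
    ring

theorem two_mul_gp_add_le (x p q : X) (a : D.Compactification) :
    2 * D.gp x (D.incl p) a + ENNReal.ofReal (dist x q) ≤
      2 * D.gp x (D.incl q) a + ENNReal.ofReal (dist x p) + ENNReal.ofReal (dist p q) := by
  refine D.dense_incl.induction (P := fun a => 2 * D.gp x (D.incl p) a + _ ≤
    2 * D.gp x (D.incl q) a + _ + _) ?_ ?_ a
  · rintro _ ⟨r, rfl⟩
    have hnn : ∀ o u v : X, 0 ≤ (dist u o + dist v o - dist u v) / 2 := fun o u v => by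
      linarith [dist_triangle_right u v o]
    rw [gp_eq, gp_eq, two_mul, two_mul, ← ENNReal.ofReal_add (hnn _ _ _) (hnn _ _ _),
      ← ENNReal.ofReal_add (hnn _ _ _) (hnn _ _ _),
      ← ENNReal.ofReal_add (add_nonneg (hnn _ _ _) (hnn _ _ _)) dist_nonneg,
      ← ENNReal.ofReal_add (add_nonneg (hnn _ _ _) (hnn _ _ _)) dist_nonneg,
      ← ENNReal.ofReal_add (add_nonneg (add_nonneg (hnn _ _ _) (hnn _ _ _)) dist_nonneg)
        dist_nonneg]
    refine ENNReal.ofReal_le_ofReal ?_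
    linarith [dist_triangle q p r, dist_comm p q, dist_comm x p, dist_comm x q]
  · exact isClosed_le
      (((ENNReal.continuous_const_mul (by simp)).comp
        (D.continuous_gp_comp x continuous_const continuous_id)).add continuous_const)
      ((((ENNReal.continuous_const_mul (by simp)).comp
        (D.continuous_gp_comp x continuous_const continuous_id)).add continuous_const).add
        continuous_const)

theorem exists_bIncl_eq {x : X} {a : D.Compactification} (ha : D.gp x a a = ⊤) :
    ∃ ξ, D.bIncl ξ = a := by
  change a ∈ Set.range D.bIncl
  rw [D.range_bIncl]
  rintro ⟨p, rfl⟩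
  exact D.gp_incl_ne_top x p _ ha

theorem exists_antipode (x : X) (ξ : D.Boundary) :
    ∃ η, D.gp x (D.bIncl ξ) (D.bIncl η) = 0 := by
  have hz : ∀ a : X, ∃ z : X, D.gp x (D.incl a) (D.incl z) = 0 ∧
      D.gp x (D.incl z) (D.incl z) = D.gp x (D.incl a) (D.incl a) := by
    intro a
    obtain ⟨γ, hγ⟩ := D.geodesic x a
    obtain ⟨γ', hiso, hext⟩ := D.geodesicallyComplete x a γ hγ
    have h0 : γ' 0 = x := (hext 0 ⟨le_rfl, dist_nonneg⟩).trans hγ.1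
    have h1 : γ' (dist x a) = a := (hext _ ⟨dist_nonneg, le_rfl⟩).trans hγ.2.1
    have hzx : dist (γ' (-dist x a)) x = dist x a := by
      conv_lhs => rw [← h0]
      rw [hiso]
      simp [h0]
    have haz : dist a (γ' (-dist x a)) = 2 * dist x a := by
      conv_lhs => rw [← h1]
      rw [hiso, h1, sub_neg_eq_add, abs_of_nonneg (by positivity)]
      ring
    refine ⟨γ' (-dist x a), ?_, ?_⟩
    · rw [gp_eq, haz, hzx, dist_comm a x]
      simp [two_mul]
    · rw [gp_eq, gp_eq, hzx, dist_comm a x, dist_self, dist_self]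
  choose z hz0 hzz using hz
  have hne : (comap D.incl (𝓝 (D.bIncl ξ))).NeBot := by
    refine comap_neBot_iff.2 fun t ht => ?_
    obtain ⟨_, hp, p, rfl⟩ := mem_closure_iff_nhds.1 (D.dense_incl (D.bIncl ξ)) t ht
    exact ⟨p, hp⟩
  let U := Ultrafilter.of (comap D.incl (𝓝 (D.bIncl ξ)))
  have hU : Tendsto D.incl U (𝓝 (D.bIncl ξ)) :=
    tendsto_comap.mono_left (Ultrafilter.of_le _)
  have := D.compactC
  obtain ⟨c, -, hc⟩ := isCompact_univ.ultrafilter_le_nhds' (U.map (D.incl ∘ z)) univ_mem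
  have hc' : Tendsto (D.incl ∘ z) U (𝓝 c) := hc
  have hcc : D.gp x c c = ⊤ := by
    have h1 := ((D.continuous_gp x).tendsto (c, c)).comp (hc'.prodMk_nhds hc')
    have h2 := ((D.continuous_gp x).tendsto (D.bIncl ξ, D.bIncl ξ)).comp (hU.prodMk_nhds hU)
    rw [← (D.gp_top_iff x ξ ξ).2 rfl]
    refine tendsto_nhds_unique h1 (h2.congr fun a => (hzz a).symm)
  obtain ⟨η, rfl⟩ := D.exists_bIncl_eq hcc
  refine ⟨η, ?_⟩
  have h1 := ((D.continuous_gp x).tendsto (D.bIncl ξ, D.bIncl η)).comp (hU.prodMk_nhds hc')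
  exact tendsto_nhds_unique h1 (tendsto_const_nhds.congr fun a => (hz0 a).symm)

theorem exists_two_mul_gp_add_eq (x p q : X) : ∃ ξ,
    2 * D.gp x (D.incl p) (D.bIncl ξ) + ENNReal.ofReal (dist x q) =
      2 * D.gp x (D.incl q) (D.bIncl ξ) + ENNReal.ofReal (dist x p) +
        ENNReal.ofReal (dist p q) := by
  obtain ⟨γ, hγ⟩ := D.geodesic q p
  obtain ⟨γ', hiso, hext⟩ := D.geodesicallyComplete q p γ hγ
  have h0 : γ' 0 = q := (hext 0 ⟨le_rfl, dist_nonneg⟩).trans hγ.1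
  have h1 : γ' (dist q p) = p := (hext _ ⟨dist_nonneg, le_rfl⟩).trans hγ.2.1
  let z : ℕ → X := fun k => γ' (dist q p + k)
  have hq : ∀ k, dist q (z k) = dist q p + k := fun k => by
    conv_lhs => rw [← h0]
    rw [hiso, zero_sub, abs_neg, abs_of_nonneg (by positivity)]
  have hp : ∀ k, dist p (z k) = k := fun k => by
    have h2 : dist (γ' (dist q p)) (γ' (dist q p + k)) = k := by
      rw [hiso, sub_add_cancel_left, abs_neg, abs_of_nonneg (by positivity)]
    rwa [h1] at h2
  let U := Ultrafilter.of (atTop : Filter ℕ)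
  have hUle : (U : Filter ℕ) ≤ atTop := Ultrafilter.of_le _
  have := D.compactC
  obtain ⟨c, -, hc⟩ := isCompact_univ.ultrafilter_le_nhds' (U.map (D.incl ∘ z)) univ_mem
  have hc' : Tendsto (D.incl ∘ z) U (𝓝 c) := hc
  have hcc : D.gp x c c = ⊤ := by
    have h2 := ((D.continuous_gp x).tendsto (c, c)).comp (hc'.prodMk_nhds hc')
    have h3 : Tendsto (fun k => dist (z k) x) atTop atTop := by
      refine tendsto_atTop_mono (f := fun k : ℕ => (k : ℝ) - dist p x) (fun k => ?_)
        (tendsto_atTop_add_const_right _ _ tendsto_natCast_atTop_atTop)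
      linarith [hp k, dist_triangle_right p (z k) x]
    refine tendsto_nhds_unique h2
      (((ENNReal.tendsto_ofReal_atTop.comp h3).mono_left hUle).congr fun k => ?_)
    simp only [Function.comp, gp_eq, dist_self]
    congr 1
    ring
  obtain ⟨ξ, rfl⟩ := D.exists_bIncl_eq hcc
  refine ⟨ξ, ?_⟩
  have hlim : ∀ r : X, Tendsto (fun k => 2 * D.gp x (D.incl r) (D.incl (z k))) U
      (𝓝 (2 * D.gp x (D.incl r) (D.bIncl ξ))) := fun r =>
    (((ENNReal.continuous_const_mul (by simp)).comp
      (D.continuous_gp_comp x continuous_const continuous_id)).tendsto _).comp hc'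
  refine tendsto_nhds_unique ((hlim p).add tendsto_const_nhds)
    ((((hlim q).add tendsto_const_nhds).add tendsto_const_nhds).congr fun k => ?_)
  have hnn : ∀ o u v : X, 0 ≤ (dist u o + dist v o - dist u v) / 2 := fun o u v => by
    linarith [dist_triangle_right u v o]
  rw [gp_eq, gp_eq, two_mul, two_mul, ← ENNReal.ofReal_add (hnn _ _ _) (hnn _ _ _),
    ← ENNReal.ofReal_add (hnn _ _ _) (hnn _ _ _),
    ← ENNReal.ofReal_add (add_nonneg (hnn _ _ _) (hnn _ _ _)) dist_nonneg,
    ← ENNReal.ofReal_add (add_nonneg (hnn _ _ _) (hnn _ _ _)) dist_nonneg,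
    ← ENNReal.ofReal_add (add_nonneg (add_nonneg (hnn _ _ _) (hnn _ _ _)) dist_nonneg)
      dist_nonneg, hp, hq, dist_comm q x, dist_comm p x, dist_comm q p]
  congr 1
  ring

theorem boundaryProd_comm (x : X) (ξ η : D.Boundary) :
    D.boundaryProd x ξ η = D.boundaryProd x η ξ := by
  rw [boundaryProd, gp_comm, boundaryProd]

theorem boundaryProd_nonneg (x : X) (ξ η : D.Boundary) : 0 ≤ D.boundaryProd x ξ η :=
  ENNReal.toReal_nonneg

theorem visual_eq_expNeg (x : X) : D.visual x = expNeg (D.boundaryProd x) := by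
  funext ξ η
  by_cases h : ξ = η
  · subst h
    rw [expNeg_self, visual, if_pos ((D.gp_top_iff x ξ ξ).2 rfl)]
  · rw [expNeg_of_ne _ h, visual, if_neg (fun hh => h ((D.gp_top_iff x ξ η).1 hh)), boundaryProd]

theorem exists_boundaryProd_eq_zero (x : X) (ξ : D.Boundary) :
    ∃ η, ξ ≠ η ∧ D.boundaryProd x ξ η = 0 := by
  obtain ⟨η, hη⟩ := D.exists_antipode x ξ
  refine ⟨η, ?_, by rw [boundaryProd, hη, ENNReal.toReal_zero]⟩
  rintro rfl
  rw [(D.gp_top_iff x ξ ξ).2 rfl] at hη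
  exact ENNReal.top_ne_zero hη

theorem busemann_add (x p : X) {ξ η : D.Boundary} (hne : ξ ≠ η) :
    D.busemann x p ξ + D.busemann x p η =
      2 * D.boundaryProd x ξ η - 2 * D.boundaryProd p ξ η := by
  have h := congrArg ENNReal.toReal (D.gp_add_gp_add_gp x p (D.bIncl ξ) (D.bIncl η))
  have h1 : ∀ r, D.gp r (D.bIncl ξ) (D.bIncl η) ≠ ⊤ := fun r hh =>
    hne ((D.gp_top_iff r ξ η).1 hh)
  have h2 := D.gp_incl_ne_top x p
  rw [ENNReal.toReal_add (ENNReal.add_ne_top.2 ⟨h1 p, h2 _⟩) (h2 _),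
    ENNReal.toReal_add (h1 p) (h2 _), ENNReal.toReal_add (h1 x) ENNReal.ofReal_ne_top,
    ENNReal.toReal_ofReal dist_nonneg] at h
  unfold busemann boundaryProd
  linarith

theorem busemann_self (x : X) (ξ : D.Boundary) : D.busemann x x ξ = 0 := by
  have h := D.gp_incl_le x x (D.bIncl ξ)
  rw [dist_self, ENNReal.ofReal_zero, nonpos_iff_eq_zero] at h
  simp [busemann, h]

theorem busemann_sub_le (x p q : X) (ξ : D.Boundary) :
    D.busemann x p ξ - D.busemann x q ξ ≤ dist p q := by
  have h2 := D.gp_incl_ne_top x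
  have hm : ∀ r, 2 * D.gp x (D.incl r) (D.bIncl ξ) ≠ ⊤ := fun r =>
    ENNReal.mul_ne_top (by simp) (h2 r _)
  have h := ENNReal.toReal_mono (by simp [h2, ENNReal.mul_eq_top])
    (D.two_mul_gp_add_le x p q (D.bIncl ξ))
  rw [ENNReal.toReal_add (hm p) ENNReal.ofReal_ne_top,
    ENNReal.toReal_add (ENNReal.add_ne_top.2 ⟨hm q, ENNReal.ofReal_ne_top⟩) ENNReal.ofReal_ne_top,
    ENNReal.toReal_add (hm q) ENNReal.ofReal_ne_top, ENNReal.toReal_mul, ENNReal.toReal_mul,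
    ENNReal.toReal_ofReal dist_nonneg, ENNReal.toReal_ofReal dist_nonneg,
    ENNReal.toReal_ofReal dist_nonneg, ENNReal.toReal_ofNat] at h
  unfold busemann
  linarith

theorem exists_busemann_sub_eq (x p q : X) :
    ∃ ξ, D.busemann x p ξ - D.busemann x q ξ = dist p q := by
  obtain ⟨ξ, hξ⟩ := D.exists_two_mul_gp_add_eq x p q
  have h2 := D.gp_incl_ne_top x
  have hm : ∀ r, 2 * D.gp x (D.incl r) (D.bIncl ξ) ≠ ⊤ := fun r =>
    ENNReal.mul_ne_top (by simp) (h2 r _)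
  have h := congrArg ENNReal.toReal hξ
  rw [ENNReal.toReal_add (hm p) ENNReal.ofReal_ne_top,
    ENNReal.toReal_add (ENNReal.add_ne_top.2 ⟨hm q, ENNReal.ofReal_ne_top⟩) ENNReal.ofReal_ne_top,
    ENNReal.toReal_add (hm q) ENNReal.ofReal_ne_top, ENNReal.toReal_mul, ENNReal.toReal_mul,
    ENNReal.toReal_ofReal dist_nonneg, ENNReal.toReal_ofReal dist_nonneg,
    ENNReal.toReal_ofReal dist_nonneg, ENNReal.toReal_ofNat] at h
  refine ⟨ξ, ?_⟩
  unfold busemann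
  linarith

theorem nonempty_boundary (x : X) : Nonempty D.Boundary :=
  ⟨(D.exists_busemann_sub_eq x x x).choose⟩

theorem abs_busemann_sub_le (x p q : X) (ξ : D.Boundary) :
    |D.busemann x p ξ - D.busemann x q ξ| ≤ dist p q :=
  abs_sub_le_iff.2 ⟨D.busemann_sub_le x p q ξ, dist_comm p q ▸ D.busemann_sub_le x q p ξ⟩

theorem isTight_busemann (x p : X) : IsTight (D.boundaryProd x) (D.busemann x p) := by
  refine ⟨fun ξ η hne => ?_, fun ξ => ?_⟩
  · linarith [D.busemann_add x p hne, D.boundaryProd_nonneg p ξ η]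
  · obtain ⟨η, hne, h0⟩ := D.exists_boundaryProd_eq_zero p ξ
    exact ⟨η, hne, by linarith [D.busemann_add x p hne]⟩

/-- When the boundary has only two points, the space is a line. -/
theorem exists_busemann_eq_of_two (x : X) {ξ η : D.Boundary} (hne : ξ ≠ η)
    (htwo : ∀ θ, θ = ξ ∨ θ = η) (v : ℝ) : ∃ p, D.busemann x p ξ = v ∧ D.busemann x p η = -v := by
  have hG : ∀ p, D.boundaryProd p ξ η = 0 := fun p => by
    obtain ⟨θ, hθ, h0⟩ := D.exists_boundaryProd_eq_zero p ξ
    rcases htwo θ with rfl | rfl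
    · exact absurd rfl hθ
    · exact h0
  have hsum : ∀ p, D.busemann x p η = -D.busemann x p ξ := fun p => by
    linarith [D.busemann_add x p hne, hG x, hG p]
  have hdist : ∀ p q, |D.busemann x p ξ - D.busemann x q ξ| = dist p q := fun p q => by
    obtain ⟨θ, hθ⟩ := D.exists_busemann_sub_eq x p q
    rcases htwo θ with rfl | rfl
    · rw [hθ, abs_of_nonneg dist_nonneg]
    · rw [hsum, hsum] at hθ
      rw [← hθ, abs_sub_comm, abs_of_nonneg] <;> linarith [dist_nonneg (x := p) (y := q)]
  suffices ∃ p, D.busemann x p ξ = v from this.imp fun p hp => ⟨hp, by rw [hsum, hp]⟩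
  obtain ⟨γ, hγ⟩ := D.geodesic x x
  obtain ⟨γ', hiso, hext⟩ := D.geodesicallyComplete x x γ hγ
  have h0 : γ' 0 = x := (hext 0 ⟨le_rfl, dist_nonneg⟩).trans hγ.1
  have habs : ∀ t, |D.busemann x (γ' t) ξ| = |t| := fun t => by
    have h1 := hdist (γ' t) (γ' 0)
    rwa [hiso, h0, D.busemann_self, sub_zero, sub_zero] at h1
  have h1 := hdist (γ' v) (γ' (-v))
  rw [hiso] at h1
  by_cases hv : v = 0
  · exact ⟨x, by rw [D.busemann_self, hv]⟩
  · rcases abs_eq_abs.1 (habs v) with h2 | h2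
    · exact ⟨_, h2⟩
    · refine ⟨γ' (-v), ?_⟩
      rcases abs_eq_abs.1 (habs (-v)) with h3 | h3
      · rw [h2, h3, sub_self, abs_zero] at h1
        exact absurd (abs_eq_zero.1 h1.symm) (fun hh => hv (by linarith))
      · rw [h3, neg_neg]

theorem IsMaximal.exists_busemann_eq {D : GromovProductData X} (hD : D.IsMaximal)
    [Finite D.Boundary] (x : X) {τ : D.Boundary → ℝ} (hτ : IsTight (D.boundaryProd x) τ) :
    ∃ p, D.busemann x p = τ := by
  have := D.t2C
  have : T2Space D.Boundary := D.isEmbedding_bIncl.t2Space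
  let B : D.Boundary → D.Boundary → ℝ := fun ξ η => D.boundaryProd x ξ η - (τ ξ + τ η) / 2
  obtain ⟨p, hp⟩ := (hD x).2 (expNeg B) (by
    refine ⟨⟨continuous_of_discreteTopology, fun ξ η => ?_, expNeg_nonneg _, fun ξ η => ?_⟩,
      fun ξ η => ?_, fun ξ => ?_⟩
    · by_cases h : ξ = η
      · rw [h]
      · rw [expNeg_of_ne _ h, expNeg_of_ne _ (Ne.symm h)]
        simp only [B, D.boundaryProd_comm x ξ η, add_comm]
    · by_cases h : ξ = η
      · simp [h, expNeg_self]
      · simp [h, expNeg_of_ne _ h, (Real.exp_pos _).ne']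
    · by_cases h : ξ = η
      · simp [h, expNeg_self]
      · rw [expNeg_of_ne _ h, Real.exp_le_one_iff]
        simp only [B]
        linarith [hτ.1 ξ η h]
    · obtain ⟨η, hne, heq⟩ := hτ.2 ξ
      refine ⟨η, ?_⟩
      rw [expNeg_of_ne _ hne, Real.exp_eq_one_iff]
      simp only [B]
      linarith)
    ⟨τ, continuous_of_discreteTopology, fun ξ η => by
      rw [visual_eq_expNeg]
      by_cases h : ξ = η
      · simp [h, expNeg_self]
      · rw [expNeg_of_ne _ h, expNeg_of_ne _ h, ← Real.exp_nat_mul, ← Real.exp_nat_mul,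
          ← Real.exp_add, ← Real.exp_add]
        congr 1
        simp only [B]
        push_cast
        ring⟩
  have hsum : ∀ ξ η, ξ ≠ η → D.busemann x p ξ + D.busemann x p η = τ ξ + τ η := by
    intro ξ η hne
    have h1 := congrFun (congrFun hp ξ) η
    rw [visual_eq_expNeg, expNeg_of_ne _ hne, expNeg_of_ne _ hne, Real.exp_eq_exp] at h1
    have h2 := D.busemann_add x p hne
    simp only [B] at h1
    linarith
  obtain ⟨ξ⟩ := D.nonempty_boundary x
  obtain ⟨η, hne, -⟩ := D.exists_boundaryProd_eq_zero x ξ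
  by_cases htwo : ∀ θ, θ = ξ ∨ θ = η
  · obtain ⟨q, hq, hq'⟩ := D.exists_busemann_eq_of_two x hne htwo (τ ξ)
    refine ⟨q, funext fun θ => ?_⟩
    rcases htwo θ with rfl | rfl
    · exact hq
    · obtain ⟨θ'', hθ'', heq⟩ := hτ.2 ξ
      have h3 : D.boundaryProd x ξ θ = 0 := by
        obtain ⟨θ₁, hθ₁, h0'⟩ := D.exists_boundaryProd_eq_zero x ξ
        rcases htwo θ₁ with rfl | rfl
        · exact absurd rfl hθ₁
        · exact h0'
      rcases htwo θ'' with rfl | rfl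
      · exact absurd rfl hθ''
      · linarith
  · push Not at htwo
    obtain ⟨ζ, hζξ, hζη⟩ := htwo
    refine ⟨p, funext fun θ => ?_⟩
    have key : ∀ a b c, a ≠ b → a ≠ c → b ≠ c → D.busemann x p a = τ a := fun a b c h1 h2 h3 => by
      linarith [hsum a b h1, hsum a c h2, hsum b c h3]
    by_cases h1 : θ = ξ
    · subst h1
      exact key θ η ζ hne hζξ.symm hζη.symm
    · by_cases h2 : θ = η
      · subst h2
        exact key θ ξ ζ h1 hζη.symm hζξ.symm
      · exact key θ ξ η h1 h2 hne

theorem IsMaximal.isTightModel {D : GromovProductData X} (hD : D.IsMaximal) [Finite D.Boundary]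
    (x : X) : IsTightModel x (D.boundaryProd x) (D.busemann x) where
  symm := D.boundaryProd_comm x
  nonneg := D.boundaryProd_nonneg x
  base := D.busemann_self x
  abs_sub_le := D.abs_busemann_sub_le x
  exists_abs_sub_eq p q := (D.exists_busemann_sub_eq x p q).imp fun ξ hξ => by
    rw [hξ, abs_of_nonneg dist_nonneg]
  isTight := D.isTight_busemann x
  surjective _ hτ := hD.exists_busemann_eq x hτ

end GromovProductData

/-- For maximal Gromov product spaces `(X n, x n)` and `(Y, y)` with finite
Gromov product boundaries (maximal Gromov hyperbolic spaces), pointed Gromov–Hausdorff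
convergence `(X n, x n) → (Y, y)` holds if and only if the boundaries
`(∂_P X n, ρ_{x n})` AI-converge to `(∂_P Y, ρ_y)`. -/
theorem GH_converges_iff_boundaries_AI_converge_of_finite_boundaries
    {X : ℕ → Type u} [∀ n, MetricSpace (X n)] (D : ∀ n, GromovProductData (X n))
    (hmax : ∀ n, (D n).IsMaximal) (hfin : ∀ n, Finite (D n).Boundary) (x : ∀ n, X n)
    {Y : Type u} [MetricSpace Y] (DY : GromovProductData Y) (hmaxY : DY.IsMaximal)
    (hfinY : Finite DY.Boundary) (y : Y) :
    PointedGHConverges X x Y y ↔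
      AIConverges (fun n => (D n).visual (x n)) (DY.visual y) := by
  have H := fun n => (hmax n).isTightModel (x n)
  have HY := hmaxY.isTightModel y
  have : Nonempty DY.Boundary := DY.nonempty_boundary y
  obtain ⟨M, hM0, hM⟩ : ∃ M, 0 ≤ M ∧ ∀ ξ η, DY.boundaryProd y ξ η ≤ M := by
    obtain ⟨M, hM⟩ := (Set.finite_range (Function.uncurry (DY.boundaryProd y))).bddAbove
    exact ⟨M, (HY.nonneg (Classical.arbitrary _) (Classical.arbitrary _)).trans
      (hM ⟨(_, _), rfl⟩), fun ξ η => hM ⟨(ξ, η), rfl⟩⟩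
  simp only [GromovProductData.visual_eq_expNeg]
  rw [pointedGHConverges_iff, aiConverges_iff (fun n => (D n).nonempty_boundary (x n))
    (fun n => expNeg_nonneg _) (fun n => expNeg_le_one (H n).nonneg) (expNeg_nonneg _)
    (expNeg_le_one HY.nonneg)]
  constructor
  · intro hGH ε hε
    have hR₀ : Real.exp (-(1 / ε)) < ε := by
      rw [Real.exp_neg, inv_lt_comm₀ (Real.exp_pos _) hε, ← one_div]
      linarith [Real.add_one_le_exp (1 / ε)]
    have hε' : 0 < 1 / ε := by positivity
    obtain ⟨N, hN⟩ := hGH (2 * M + 1 / ε + 10) (by positivity) (min 1 (ε / 4)) (by positivity)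
    refine ⟨N, fun n hn => ?_⟩
    obtain ⟨F, hF⟩ := hN n hn
    obtain ⟨f, hf⟩ := hF.exists_isCoarseMatch (H n) HY hM0 (fun ξ η _ => hM ξ η) (R₀ := 1 / ε)
      (δ := ε / 2) le_rfl hε'.le (min_le_left _ _) (by linarith [min_le_right 1 (ε / 4)])
    exact ⟨f, hf.isEpsIsometry (H n).nonneg HY.nonneg (half_lt_self hε) hR₀ hε⟩
  · intro hAI R hR ε hε
    have hδ : 0 < ε / 23 := by positivity
    have hpos : 0 < Real.exp (-M) * (1 - Real.exp (-(ε / 23))) :=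
      mul_pos (Real.exp_pos _) (sub_pos.2 (Real.exp_lt_one_iff.2 (by linarith)))
    obtain ⟨N, hN⟩ := hAI (min (Real.exp (-M) * (1 - Real.exp (-(ε / 23)))) (Real.exp (-R)))
      (lt_min hpos (Real.exp_pos _))
    refine ⟨N, fun n hn => ?_⟩
    obtain ⟨f, hf⟩ := hN n hn
    exact (hf.isCoarseMatch (fun ξ η _ => hM ξ η) hδ.le (min_le_left _ _)
      (min_le_right _ _)).exists_isBallApprox (H n) HY hR.le hδ.le (by linarith)
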